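/- Let ρ : ℝ^{n_k} × [0,∞) → ℝ be such that for each fixed k the map t ↦ ρ(k,t) is differentiable, and let β : ℝ → ℝ be an extended class K function (locally Lipschitz, strictly increasing, β(0) = 0). Suppose ∂_t ρ(k,t) + β(ρ(k,t)) ≥ 0 for all k and all t ≥ 0. Then the time-varying parameter set K(t) = {k ∈ ℝ^{n_k} : ρ(k,t) ≥ 0} is nondecreasing: for all 0 ≤ t₁ ≤ t₂, K(t₁) ⊆ K(t₂). -/

import Mathlib

/-- An extended class K function: locally Lipschitz, strictly increasing, vanishing at 0. -/
def IsExtClassK (β : ℝ → ℝ) : Prop :=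
  LocallyLipschitz β ∧ StrictMono β ∧ β 0 = 0

/-- A function that has positive derivative wherever it is negative stays nonnegative
once it is nonnegative. -/
theorem nonneg_of_hasDerivAt_pos_of_neg {f f' : ℝ → ℝ} {a b : ℝ} (hab : a ≤ b)
    (hf : ∀ t ∈ Set.Icc a b, HasDerivAt f (f' t) t)
    (hpos : ∀ t ∈ Set.Icc a b, f t < 0 → 0 < f' t) (ha : 0 ≤ f a) : 0 ≤ f b := by
  refine le_of_forall_pos_le_add fun ε hε => ?_
  have h := image_le_of_deriv_right_lt_deriv_boundary (f := fun t => -f t)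
    (f' := fun t => -f' t) (B := fun _ => ε) (B' := fun _ => 0) (a := a) (b := b)
    (fun t ht => (hf t ht).continuousAt.neg.continuousWithinAt)
    (fun t ht => (hf t (Set.Ico_subset_Icc_self ht)).neg.hasDerivWithinAt)
    (by linarith) (fun t => hasDerivAt_const t ε)
    (fun t ht h => neg_neg_of_pos (hpos t (Set.Ico_subset_Icc_self ht) (by linarith)))
    (Set.right_mem_Icc.2 hab)
  linarith

/-- **Monotonicity of a relaxing time-varying parameter set.** If for each fixed `k`
the map `t ↦ ρ(k,t)` is differentiable with `∂ₜρ(k,t) + β(ρ(k,t)) ≥ 0` for all `t ≥ 0`,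
where `β` is an extended class K function, then the time-varying parameter set
`K(t) = {k : ρ(k,t) ≥ 0}` is nondecreasing: `K(t₁) ⊆ K(t₂)` whenever `0 ≤ t₁ ≤ t₂`. -/
theorem timeVarying_parameter_set_monotone {nk : ℕ}
    (ρ : (Fin nk → ℝ) → ℝ → ℝ) (ρt : (Fin nk → ℝ) → ℝ → ℝ)
    (hderiv : ∀ k : Fin nk → ℝ, ∀ t : ℝ, 0 ≤ t → HasDerivAt (ρ k) (ρt k t) t)
    (β : ℝ → ℝ) (hβ : IsExtClassK β)
    (hineq : ∀ k : Fin nk → ℝ, ∀ t : ℝ, 0 ≤ t → ρt k t + β (ρ k t) ≥ 0) :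
    ∀ t₁ t₂ : ℝ, 0 ≤ t₁ → t₁ ≤ t₂ →
      {k : Fin nk → ℝ | 0 ≤ ρ k t₁} ⊆ {k : Fin nk → ℝ | 0 ≤ ρ k t₂} := by
  intro t₁ t₂ h₁ h₁₂ k hk
  refine nonneg_of_hasDerivAt_pos_of_neg h₁₂ (fun t ht => hderiv k t (h₁.trans ht.1))
    (fun t ht hneg => ?_) hk
  have hβneg : β (ρ k t) < 0 := hβ.2.2 ▸ hβ.2.1 hneg
  linarith [hineq k t (h₁.trans ht.1)]
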